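/- (Data scaling preserves ranking, permutation version.) Let n be a positive natural number, Q : Fin n → Fin n → Fin n → Fin n → ℝ, ĵ ∈ Fin n, and Δ ∈ ℝ. Define the scaled matrix Q̃ by Q̃ u i v j = Q u i v j + Δ if j = ĵ and Q̃ u i v j = Q u i v j otherwise. For a permutation σ of Fin n, let x_σ u i = 1 if σ u = i and x_σ u i = 0 otherwise. Then for any two permutations σ and τ of Fin n, f_Q(x_σ) < f_Q(x_τ) implies f_{Q̃}(x_σ) < f_{Q̃}(x_τ). -/

import Mathlib

/-- The quadratic objective `f_Q(x) = ∑_{u,i,v,j} x u i * Q u i v j * x v j`. -/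
def objective {n : ℕ} (Q : Fin n → Fin n → Fin n → Fin n → ℝ)
    (x : Fin n → Fin n → ℝ) : ℝ :=
  ∑ u : Fin n, ∑ i : Fin n, ∑ v : Fin n, ∑ j : Fin n, x u i * Q u i v j * x v j

/-- The permutation matrix associated with a permutation `σ` of `Fin n`. -/
def permMatrix {n : ℕ} (σ : Equiv.Perm (Fin n)) : Fin n → Fin n → ℝ :=
  fun u i => if σ u = i then 1 else 0

/-- On a permutation matrix the objective collapses to a double sum. -/
theorem objective_perm_eq {n : ℕ} (Q : Fin n → Fin n → Fin n → Fin n → ℝ)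
    (σ : Equiv.Perm (Fin n)) :
    objective Q (permMatrix σ) = ∑ u : Fin n, ∑ v : Fin n, Q u (σ u) v (σ v) := by
  unfold objective permMatrix
  refine Finset.sum_congr rfl fun u _ => ?_
  rw [Finset.sum_eq_single (σ u)]
  · simp
  · intro i _ hi
    simp [Ne.symm hi]
  · simp

/-- Scaling shifts the objective of each permutation matrix by `n * Δ`. -/
theorem objective_scaled_perm {n : ℕ} (Q : Fin n → Fin n → Fin n → Fin n → ℝ)
    (jhat : Fin n) (Δ : ℝ) (σ : Equiv.Perm (Fin n)) :
    objective (fun u i v j => if j = jhat then Q u i v j + Δ else Q u i v j)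
        (permMatrix σ) = objective Q (permMatrix σ) + n * Δ := by
  rw [objective_perm_eq, objective_perm_eq]
  have key : ∀ u : Fin n,
      (∑ v : Fin n, if σ v = jhat then Q u (σ u) v (σ v) + Δ else Q u (σ u) v (σ v))
        = (∑ v : Fin n, Q u (σ u) v (σ v)) + Δ := by
    intro u
    have hs : (∑ v : Fin n, if σ v = jhat then Δ else 0) = Δ := by
      rw [Equiv.sum_comp σ (fun j => if j = jhat then Δ else 0)]
      simp
    conv_rhs => rw [← hs]
    rw [← Finset.sum_add_distrib]
    refine Finset.sum_congr rfl fun v _ => ?_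
    split_ifs <;> simp
  simp only [key, Finset.sum_add_distrib]
  simp

theorem scaling_preserves_ranking_perm {n : ℕ} (hn : 0 < n)
    (Q : Fin n → Fin n → Fin n → Fin n → ℝ) (jhat : Fin n) (Δ : ℝ)
    (σ τ : Equiv.Perm (Fin n))
    (h : objective Q (permMatrix σ) < objective Q (permMatrix τ)) :
    objective (fun u i v j => if j = jhat then Q u i v j + Δ else Q u i v j)
        (permMatrix σ)
      < objective (fun u i v j => if j = jhat then Q u i v j + Δ else Q u i v j)
        (permMatrix τ) := by
  rw [objective_scaled_perm, objective_scaled_perm]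
  linarith
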